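/- Let R be a commutative ring, S ≥ 1, N, D natural numbers, a : Fin (S−1) → R, b : Fin (S−1) → R and a₀ ∈ R. Define the (2S−1)×(2S−1) matrix M over R with rows indexed by (Fin S) ⊕ (Fin (S−1)) (relator rows r₁,…,r_S, then commutator rows s₁,…,s_{S−1}) and columns given by: a column of a₀, then columns of a₁,…,a_{S−1}, then columns of b₁,…,b_{S−1} (the column of b_S is deleted), with entries: the a₀-column has entry g_N(a₀) in every relator row rᵢ (1 ≤ i ≤ S) and 0 in every commutator row; for i ∈ Fin (S−1), row rᵢ has −g_N(aᵢ) in column aᵢ and −aᵢᴺ·g_D(bᵢ) in column bᵢ; for j ∈ Fin (S−1), row s_j has 1 − b_j in column a_j and a_j − 1 in column b_j; all other entries are 0 (in particular row r_S is nonzero only in the a₀-column). Then det M = (−1)^{S+1} · g_N(a₀) · ∏_{i=1}^{S−1} (1 − aᵢᴺ·bᵢᴰ). (This is the Type IV minor of the Alexander matrix of the tst link [Φ^μ(n(τ), d(τ), M)] with M even, obtained by deleting the column of b_S.) -/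

import Mathlib

/-- The geometric sum `g_m(x) = ∑_{k=0}^{m-1} xᵏ`, the group-ring analogue of `(1-xᵐ)/(1-x)`. -/
def geomSum {R : Type*} [CommRing R] (m : ℕ) (x : R) : R := ∑ k ∈ Finset.range m, x ^ k

lemma geomSum_mul_aux {R : Type*} [CommRing R] (m : ℕ) (x : R) :
    geomSum m x * (x - 1) = x ^ m - 1 := by
  unfold geomSum
  exact geom_sum_mul x m

lemma det_four_diag {R : Type*} [CommRing R] (n : ℕ) (p q r s : Fin n → R) :
    (Matrix.fromBlocks (Matrix.diagonal p) (Matrix.diagonal q) (Matrix.diagonal r)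
      (Matrix.diagonal s)).det = ∏ i, (p i * s i - q i * r i) := by
  have h := Matrix.det_blockDiagonal (fun i => !![p i, q i; r i, s i])
  simp only [Matrix.det_fin_two_of] at h
  rw [← h]
  let e : Fin n ⊕ Fin n ≃ Fin 2 × Fin n :=
    (Equiv.boolProdEquivSum (Fin n)).symm.trans (finTwoEquiv.symm.prodCongr (Equiv.refl _))
  rw [← Matrix.det_submatrix_equiv_self e]
  congr 1
  ext i j
  rcases i with i | i <;> rcases j with j | j <;>
    simp [e, Matrix.blockDiagonal_apply, Matrix.diagonal_apply, finTwoEquiv]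

lemma typeIV_aux {R : Type*} [CommRing R] (n N D : ℕ)
    (a : Fin n → R) (b : Fin n → R) (a₀ : R)
    (M : Matrix (Fin (n + 1) ⊕ Fin n) (Fin (n + 1) ⊕ Fin n) R)
    (h_ra : ∀ (i : Fin (n + 1)) (c : Fin (n + 1)), M (Sum.inl i) (Sum.inl c) =
      if h0 : (c : ℕ) = 0 then geomSum N a₀
      else if (c : ℕ) = (i : ℕ) + 1 then
        -(geomSum N (a ⟨(c : ℕ) - 1, by have := c.isLt; omega⟩))
      else 0)
    (h_rb : ∀ (i : Fin (n + 1)) (c : Fin n), M (Sum.inl i) (Sum.inr c) =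
      if (c : ℕ) = (i : ℕ) then -((a c) ^ N * geomSum D (b c)) else 0)
    (h_sa : ∀ (s : Fin n) (c : Fin (n + 1)), M (Sum.inr s) (Sum.inl c) =
      if (c : ℕ) = (s : ℕ) + 1 then 1 - b s else 0)
    (h_sb : ∀ (s : Fin n) (c : Fin n), M (Sum.inr s) (Sum.inr c) =
      if c = s then a s - 1 else 0) :
    M.det = (-1) ^ (n + 1 + 1) * geomSum N a₀ *
      ∏ i : Fin n, (1 - (a i) ^ N * (b i) ^ D) := by
  let σ : Equiv.Perm (Fin (n + 1) ⊕ Fin n) := Equiv.sumCongr (finRotate (n + 1)).symm (Equiv.refl _)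
  have hσ : Equiv.Perm.sign σ = (-1) ^ n := by
    have := Equiv.Perm.sign_sumCongr (finRotate (n + 1)).symm (Equiv.refl (Fin n))
    simp only [σ]
    rw [Equiv.Perm.sumCongr] at this
    rw [this]
    simp [Equiv.Perm.sign_symm, sign_finRotate]
  have hdet := Matrix.det_permute σ M
  let e : Unit ⊕ (Fin n ⊕ Fin n) ≃ Fin (n + 1) ⊕ Fin n :=
    (Equiv.sumAssoc _ _ _).symm.trans (Equiv.sumCongr
      (((finSuccEquiv n).trans (Equiv.optionEquivSumPUnit _)).trans (Equiv.sumComm _ _)).symm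
      (Equiv.refl _))
  have e0 : e (Sum.inl ()) = Sum.inl 0 := by simp [e]
  have e1 : ∀ i, e (Sum.inr (Sum.inl i)) = Sum.inl i.succ := by intro i; simp [e]
  have e2 : ∀ i, e (Sum.inr (Sum.inr i)) = Sum.inr i := by intro i; simp [e]
  have s0 : σ (Sum.inl 0) = Sum.inl (Fin.last n) := by
    simp only [σ, Equiv.sumCongr_apply, Sum.map_inl]
    rw [(Equiv.symm_apply_eq _).2 finRotate_last.symm]
  have s1 : ∀ i : Fin n, σ (Sum.inl i.succ) = Sum.inl i.castSucc := by
    intro i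
    simp only [σ, Equiv.sumCongr_apply, Sum.map_inl]
    rw [(Equiv.symm_apply_eq _).2]
    rw [finRotate_succ_apply, Fin.coeSucc_eq_succ]
  have s2 : ∀ i : Fin n, σ (Sum.inr i) = Sum.inr i := by intro i; simp [σ]
  have key : (M.submatrix σ id).submatrix e e = Matrix.fromBlocks
      (Matrix.of fun _ _ => geomSum N a₀) 0
      (Matrix.of fun i _ => Sum.elim (fun _ => geomSum N a₀) (fun _ => 0) i)
      (Matrix.fromBlocks (Matrix.diagonal fun i => -geomSum N (a i))
        (Matrix.diagonal fun i => -((a i) ^ N * geomSum D (b i)))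
        (Matrix.diagonal fun i => 1 - b i) (Matrix.diagonal fun i => a i - 1)) := by
    ext i j
    rcases i with i | i | i <;> rcases j with j | j | j <;>
      simp only [Matrix.submatrix_apply, id, e0, e1, e2, s0, s1, s2, h_ra, h_rb, h_sa, h_sb,
        Matrix.fromBlocks_apply₁₁, Matrix.fromBlocks_apply₁₂, Matrix.fromBlocks_apply₂₁,
        Matrix.fromBlocks_apply₂₂, Matrix.of_apply, Matrix.diagonal_apply, Matrix.zero_apply,
        Sum.elim_inl, Sum.elim_inr]
    · simp
    · have := j.isLt
      simp; omega
    · have := j.isLt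
      simp; omega
    · simp
    · by_cases h : i = j
      · subst h; simp
      · have : (j : ℕ) ≠ i := fun h' => h (Fin.ext h'.symm)
        simp [h, this]
    · by_cases h : i = j
      · subst h; simp
      · have : (j : ℕ) ≠ i := fun h' => h (Fin.ext h'.symm)
        simp [h, this]
    · simp
    · by_cases h : i = j
      · subst h; simp
      · have : (j : ℕ) ≠ i := fun h' => h (Fin.ext h'.symm)
        simp [h, this]
    · simp [eq_comm]
  have hd2 : (M.submatrix σ id).det = geomSum N a₀ * ∏ i, (1 - (a i) ^ N * (b i) ^ D) := by
    rw [← Matrix.det_submatrix_equiv_self e, key, Matrix.det_fromBlocks_zero₁₂, det_four_diag]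
    congr 1
    · simp
    · refine Finset.prod_congr rfl fun i _ => ?_
      linear_combination (-1 : R) * geomSum_mul_aux N (a i) - (a i) ^ N * geomSum_mul_aux D (b i)
  rw [hd2, hσ] at hdet
  have hs : ((-1 : R) ^ n) * (-1) ^ n = 1 := by rw [← mul_pow]; simp
  push_cast at hdet
  rw [mul_assoc, hdet, ← mul_assoc, pow_add, pow_add]
  linear_combination (-M.det) * hs

open Matrix in
/-- Type IV minor of the Alexander matrix of a tst link with `M` even: the column of
`b_S` is deleted.  Rows: `Sum.inl i` = relator row `r_{i+1}` (`i : Fin S`),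
`Sum.inr s` = commutator row `s_{s+1}` (`s : Fin (S-1)`).  Columns: `Sum.inl c`
(`c : Fin S`) is the `a₀`-column when `c = 0` and the column of `a_c` when `c ≥ 1`;
`Sum.inr c` (`c : Fin (S-1)`) is the column of `b_{c+1}`. -/
theorem typeIV_minor_even {R : Type*} [CommRing R] (S N D : ℕ) (hS : 1 ≤ S)
    (a : Fin (S - 1) → R) (b : Fin (S - 1) → R) (a₀ : R)
    (M : Matrix (Fin S ⊕ Fin (S - 1)) (Fin S ⊕ Fin (S - 1)) R)
    (h_ra : ∀ (i : Fin S) (c : Fin S), M (Sum.inl i) (Sum.inl c) =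
      if h0 : (c : ℕ) = 0 then geomSum N a₀
      else if (c : ℕ) = (i : ℕ) + 1 then
        -(geomSum N (a ⟨(c : ℕ) - 1, by have := c.isLt; omega⟩))
      else 0)
    (h_rb : ∀ (i : Fin S) (c : Fin (S - 1)), M (Sum.inl i) (Sum.inr c) =
      if (c : ℕ) = (i : ℕ) then -((a c) ^ N * geomSum D (b c)) else 0)
    (h_sa : ∀ (s : Fin (S - 1)) (c : Fin S), M (Sum.inr s) (Sum.inl c) =
      if (c : ℕ) = (s : ℕ) + 1 then 1 - b s else 0)
    (h_sb : ∀ (s : Fin (S - 1)) (c : Fin (S - 1)), M (Sum.inr s) (Sum.inr c) =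
      if c = s then a s - 1 else 0) :
    M.det = (-1) ^ (S + 1) * geomSum N a₀ *
      ∏ i : Fin (S - 1), (1 - (a i) ^ N * (b i) ^ D) := by
  obtain ⟨n, rfl⟩ : ∃ n, S = n + 1 := ⟨S - 1, by omega⟩
  exact typeIV_aux n N D a b a₀ M h_ra h_rb h_sa h_sb
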